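/- Let λ ∈ h* satisfy λ(z) ≠ 0 and λ(h) ∈ {-1/2, 1/2, 3/2, 5/2, ...}. Then there is a non-split short exact sequence of U-modules 0 → Δ(r·λ) → Δ(λ) → L(λ) → 0, where (r·λ)(h) = -λ(h) - 3 and (r·λ)(z) = λ(z). -/

import Mathlib

namespace Schrodinger

noncomputable section

open scoped TensorProduct

/-- Generators of the Schrödinger algebra. -/
inductive Gen : Type
  | E | H | F | P | Q | Z
  deriving DecidableEq

/-- The free algebra on the generators. -/
abbrev FA : Type := FreeAlgebra ℂ Gen

/-- Inclusion of generators. -/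
def ιg (g : Gen) : FA := FreeAlgebra.ι ℂ g

/-- The defining relations of the universal enveloping algebra of the Schrödinger
algebra `s`: `z` is central and `[h,e]=2e`, `[e,f]=h`, `[h,f]=-2f`, `[e,q]=p`,
`[e,p]=0`, `[h,p]=p`, `[f,p]=q`, `[f,q]=0`, `[h,q]=-q`, `[p,q]=z`. -/
inductive Rel : FA → FA → Prop
  | he : Rel (ιg .H * ιg .E) (ιg .E * ιg .H + 2 * ιg .E)
  | ef : Rel (ιg .E * ιg .F) (ιg .F * ιg .E + ιg .H)
  | hf : Rel (ιg .H * ιg .F) (ιg .F * ιg .H - 2 * ιg .F)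
  | eq : Rel (ιg .E * ιg .Q) (ιg .Q * ιg .E + ιg .P)
  | ep : Rel (ιg .E * ιg .P) (ιg .P * ιg .E)
  | hp : Rel (ιg .H * ιg .P) (ιg .P * ιg .H + ιg .P)
  | fp : Rel (ιg .F * ιg .P) (ιg .P * ιg .F + ιg .Q)
  | fq : Rel (ιg .F * ιg .Q) (ιg .Q * ιg .F)
  | hq : Rel (ιg .H * ιg .Q) (ιg .Q * ιg .H - ιg .Q)
  | pq : Rel (ιg .P * ιg .Q) (ιg .Q * ιg .P + ιg .Z)
  | ze : Rel (ιg .Z * ιg .E) (ιg .E * ιg .Z)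
  | zh : Rel (ιg .Z * ιg .H) (ιg .H * ιg .Z)
  | zf : Rel (ιg .Z * ιg .F) (ιg .F * ιg .Z)
  | zp : Rel (ιg .Z * ιg .P) (ιg .P * ιg .Z)
  | zq : Rel (ιg .Z * ιg .Q) (ιg .Q * ιg .Z)

/-- The universal enveloping algebra `U = U(s)` of the Schrödinger algebra,
presented by generators and relations (via the PBW theorem). -/
abbrev U : Type := RingQuot Rel

/-- The generators of `U`. -/
def gen (g : Gen) : U := RingQuot.mkAlgHom ℂ Rel (ιg g)

def E : U := gen .E
def H : U := gen .H
def F : U := gen .F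
def P : U := gen .P
def Q : U := gen .Q
def Z : U := gen .Z

/-- Scalars inside `U`. -/
def sc (a : ℂ) : U := algebraMap ℂ U a

/-- The Casimir element `c = (h² + h + 4fe)z − 2(fp² − eq² − hpq)`. -/
def cElt : U := (H * H + H + 4 * (F * E)) * Z - 2 * (F * (P * P) - E * (Q * Q) - H * (P * Q))

/-- The left ideal of `U` defining the Verma module `Δ(λ)` for
`λ ∈ 𝔥*` with `λ(h) = hh`, `λ(z) = zz`:  it is generated by `n₊ = span{e,p}`
together with `h - λ(h)` and `z - λ(z)`; then
`Δ(λ) = U ⊗_{U(𝔟)} ℂ_λ ≅ U / U(e, p, h - λ(h), z - λ(z))`. -/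
def vermaIdeal (hh zz : ℂ) : Submodule U U :=
  Submodule.span U ({E, P, H - sc hh, Z - sc zz} : Set U)

/-- The Verma module `Δ(λ)` with highest weight `λ`, `λ(h) = hh`, `λ(z) = zz`. -/
abbrev Verma (hh zz : ℂ) : Type := U ⧸ vermaIdeal hh zz

/-- The canonical highest weight generator `v_λ` of `Δ(λ)`. -/
def hwVec (hh zz : ℂ) : Verma hh zz := Submodule.Quotient.mk 1

/-- The unique maximal submodule `K(λ)` of `Δ(λ)`. -/
def vermaRad (hh zz : ℂ) : Submodule U (Verma hh zz) := sSup {N : Submodule U (Verma hh zz) | N ≠ ⊤}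

/-- The simple highest weight module `L(λ) = Δ(λ)/K(λ)`. -/
abbrev SimpleHW (hh zz : ℂ) : Type := Verma hh zz ⧸ vermaRad hh zz

/-- The scalar `ϑ_λ = (λ(h)² + 3λ(h) + 2)·λ(z)` by which the Casimir element `c`
acts on the Verma module `Δ(λ)`. -/
def vartheta (hh zz : ℂ) : ℂ := (hh ^ 2 + 3 * hh + 2) * zz

end

end Schrodinger

namespace Schrodinger

noncomputable section

/-- The underlying space of the explicit model of `Δ(λ)`, where `μ = λ(h) + 1/2` and `ζ = λ(z)`. -/
def Model (_μ : ℂ) (_ζ : ℂˣ) : Type := ℕ × ℕ →₀ ℂ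

variable {μ : ℂ} {ζ : ℂˣ}

instance : AddCommGroup (Model μ ζ) := inferInstanceAs (AddCommGroup (ℕ × ℕ →₀ ℂ))

instance : Module ℂ (Model μ ζ) := inferInstanceAs (Module ℂ (ℕ × ℕ →₀ ℂ))

namespace Model

/-- The standard basis of the model, indexed by pairs of natural numbers. -/
def basis (μ : ℂ) (ζ : ℂˣ) : Module.Basis (ℕ × ℕ) ℂ (Model μ ζ) :=
  Module.Basis.ofRepr (LinearEquiv.refl ℂ (ℕ × ℕ →₀ ℂ))

/-- The basis vector of the model that corresponds to `(f + q² / 2ζ)ⁱ qʲ v`. -/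
def b (μ : ℂ) (ζ : ℂˣ) (i j : ℕ) : Model μ ζ := basis μ ζ (i, j)

/-- The operators by which the generators act on the model. -/
def genOp (μ : ℂ) (ζ : ℂˣ) : Gen → Module.End ℂ (Model μ ζ)
  | .E => (basis μ ζ).constr ℂ fun x =>
      ((x.1 : ℂ) * (μ - x.1 + 1)) • b μ ζ (x.1 - 1) x.2 +
        ((ζ : ℂ) / 2 * x.2 * (x.2 - 1)) • b μ ζ x.1 (x.2 - 2)
  | .H => (basis μ ζ).constr ℂ fun x => (μ - 2 * x.1 - x.2 - 1 / 2 : ℂ) • b μ ζ x.1 x.2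
  | .F => (basis μ ζ).constr ℂ fun x =>
      b μ ζ (x.1 + 1) x.2 - (2 * (ζ : ℂ))⁻¹ • b μ ζ x.1 (x.2 + 2)
  | .P => (basis μ ζ).constr ℂ fun x => ((ζ : ℂ) * x.2) • b μ ζ x.1 (x.2 - 1)
  | .Q => (basis μ ζ).constr ℂ fun x => b μ ζ x.1 (x.2 + 1)
  | .Z => (basis μ ζ).constr ℂ fun x => (ζ : ℂ) • b μ ζ x.1 x.2

lemma genOp_E (i j : ℕ) : genOp μ ζ .E (b μ ζ i j) =
    ((i : ℂ) * (μ - i + 1)) • b μ ζ (i - 1) j +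
      ((ζ : ℂ) / 2 * j * (j - 1)) • b μ ζ i (j - 2) :=
  (basis μ ζ).constr_basis ℂ _ (i, j)

lemma genOp_H (i j : ℕ) : genOp μ ζ .H (b μ ζ i j) =
    (μ - 2 * i - j - 1 / 2 : ℂ) • b μ ζ i j :=
  (basis μ ζ).constr_basis ℂ _ (i, j)

lemma genOp_F (i j : ℕ) : genOp μ ζ .F (b μ ζ i j) =
    b μ ζ (i + 1) j - (2 * (ζ : ℂ))⁻¹ • b μ ζ i (j + 2) :=
  (basis μ ζ).constr_basis ℂ _ (i, j)

lemma genOp_P (i j : ℕ) : genOp μ ζ .P (b μ ζ i j) = ((ζ : ℂ) * j) • b μ ζ i (j - 1) :=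
  (basis μ ζ).constr_basis ℂ _ (i, j)

lemma genOp_Q (i j : ℕ) : genOp μ ζ .Q (b μ ζ i j) = b μ ζ i (j + 1) :=
  (basis μ ζ).constr_basis ℂ _ (i, j)

lemma genOp_Z (i j : ℕ) : genOp μ ζ .Z (b μ ζ i j) = (ζ : ℂ) • b μ ζ i j :=
  (basis μ ζ).constr_basis ℂ _ (i, j)

lemma hom_ext {M : Type*} [AddCommGroup M] [Module ℂ M] {S T : Model μ ζ →ₗ[ℂ] M}
    (h : ∀ i j, S (b μ ζ i j) = T (b μ ζ i j)) : S = T :=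
  (basis μ ζ).ext fun x => h x.1 x.2

lemma genOp_rel {x y : FA} (h : Rel x y) :
    FreeAlgebra.lift ℂ (genOp μ ζ) x = FreeAlgebra.lift ℂ (genOp μ ζ) y := by
  have hζ : (ζ : ℂ) ≠ 0 := ζ.ne_zero
  have h2 : FreeAlgebra.lift ℂ (genOp μ ζ) 2 = (2 : ℂ) • (1 : Module.End ℂ (Model μ ζ)) := by
    rw [← one_add_one_eq_two, map_add, map_one, ← one_add_one_eq_two, add_smul, one_smul]
  cases h <;> refine hom_ext fun i j => ?_ <;>
    rcases i with _ | i <;> rcases j with _ | _ | _ | j <;>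
    simp [ιg, genOp_E, genOp_H, genOp_F, genOp_P, genOp_Q, genOp_Z, h2, smul_smul, add_assoc] <;>
    match_scalars <;> field_simp <;> ring

/-- The representation of `U` on the model. -/
def rep (μ : ℂ) (ζ : ℂˣ) : U →ₐ[ℂ] Module.End ℂ (Model μ ζ) :=
  RingQuot.liftAlgHom ℂ ⟨FreeAlgebra.lift ℂ (genOp μ ζ), fun _ _ h => genOp_rel h⟩

instance : Module U (Model μ ζ) := Module.compHom _ (rep μ ζ).toRingHom

lemma smul_def (u : U) (x : Model μ ζ) : u • x = rep μ ζ u x := rfl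

instance : IsScalarTower ℂ U (Model μ ζ) := ⟨fun a u x => by simp [smul_def]⟩

lemma gen_smul (g : Gen) (x : Model μ ζ) : gen g • x = genOp μ ζ g x := by
  rw [smul_def, gen, rep, RingQuot.liftAlgHom_mkAlgHom_apply, ιg, FreeAlgebra.lift_ι_apply]

lemma E_smul_b (i j : ℕ) : E • b μ ζ i j =
    ((i : ℂ) * (μ - i + 1)) • b μ ζ (i - 1) j +
      ((ζ : ℂ) / 2 * j * (j - 1)) • b μ ζ i (j - 2) := by
  rw [E, gen_smul, genOp_E]

lemma H_smul_b (i j : ℕ) : H • b μ ζ i j = (μ - 2 * i - j - 1 / 2 : ℂ) • b μ ζ i j := by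
  rw [H, gen_smul, genOp_H]

lemma F_smul_b (i j : ℕ) : F • b μ ζ i j =
    b μ ζ (i + 1) j - (2 * (ζ : ℂ))⁻¹ • b μ ζ i (j + 2) := by
  rw [F, gen_smul, genOp_F]

lemma P_smul_b (i j : ℕ) : P • b μ ζ i j = ((ζ : ℂ) * j) • b μ ζ i (j - 1) := by
  rw [P, gen_smul, genOp_P]

lemma Q_smul_b (i j : ℕ) : Q • b μ ζ i j = b μ ζ i (j + 1) := by
  rw [Q, gen_smul, genOp_Q]

lemma Z_smul_b (i j : ℕ) : Z • b μ ζ i j = (ζ : ℂ) • b μ ζ i j := by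
  rw [Z, gen_smul, genOp_Z]

end Model

section Relations

lemma gen_rel {x y : FA} (h : Rel x y) : RingQuot.mkAlgHom ℂ Rel x = RingQuot.mkAlgHom ℂ Rel y :=
  RingQuot.mkAlgHom_rel ℂ h

lemma E_mul_F : E * F = F * E + H := by
  simpa only [E, H, F, P, Q, Z, gen, map_mul, map_add] using gen_rel Rel.ef

lemma H_mul_F : H * F = F * H - 2 * F := by
  simpa only [E, H, F, P, Q, Z, gen, map_mul, map_sub, map_ofNat] using gen_rel Rel.hf

lemma E_mul_Q : E * Q = Q * E + P := by
  simpa only [E, H, F, P, Q, Z, gen, map_mul, map_add] using gen_rel Rel.eq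

lemma F_mul_P : F * P = P * F + Q := by
  simpa only [E, H, F, P, Q, Z, gen, map_mul, map_add] using gen_rel Rel.fp

lemma F_mul_Q : F * Q = Q * F := by
  simpa only [E, H, F, P, Q, Z, gen, map_mul] using gen_rel Rel.fq

lemma H_mul_Q : H * Q = Q * H - Q := by
  simpa only [E, H, F, P, Q, Z, gen, map_mul, map_sub] using gen_rel Rel.hq

lemma P_mul_Q : P * Q = Q * P + Z := by
  simpa only [E, H, F, P, Q, Z, gen, map_mul, map_add] using gen_rel Rel.pq

lemma Z_mul_gen (g : Gen) : Z * gen g = gen g * Z := by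
  cases g
  · simpa only [E, H, F, P, Q, Z, gen, map_mul] using gen_rel Rel.ze
  · simpa only [E, H, F, P, Q, Z, gen, map_mul] using gen_rel Rel.zh
  · simpa only [E, H, F, P, Q, Z, gen, map_mul] using gen_rel Rel.zf
  · simpa only [E, H, F, P, Q, Z, gen, map_mul] using gen_rel Rel.zp
  · simpa only [E, H, F, P, Q, Z, gen, map_mul] using gen_rel Rel.zq
  · rfl

end Relations

section Modules

variable {M N : Type*} [AddCommGroup M] [Module U M] [AddCommGroup N] [Module U N]

/-- The action of an element of `U`, as a plain function. Writing `u • x` in this way hides it from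
`module` and `match_scalars`, which are then applied over `ℂ`. -/
def act (u : U) (x : M) : M := u • x

lemma act_def (u : U) (x : M) : act u x = u • x := rfl

lemma smul_E_F (x : M) : E • F • x = F • E • x + H • x := by
  rw [smul_smul, E_mul_F, add_smul, mul_smul]

lemma smul_E_Q (x : M) : E • Q • x = Q • E • x + P • x := by
  rw [smul_smul, E_mul_Q, add_smul, mul_smul]

lemma smul_F_P (x : M) : F • P • x = P • F • x + Q • x := by
  rw [smul_smul, F_mul_P, add_smul, mul_smul]

lemma smul_P_F (x : M) : P • F • x = F • P • x - Q • x := by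
  rw [smul_F_P, add_sub_cancel_right]

lemma smul_Q_F (x : M) : Q • F • x = F • Q • x := by
  rw [smul_smul, ← F_mul_Q, mul_smul]

lemma smul_H_Q (x : M) : H • Q • x = Q • H • x - Q • x := by
  rw [smul_smul, H_mul_Q, sub_smul, mul_smul]

/-- The element `f + q² / 2ζ`, which commutes with `p` and `q` where `z` acts by `ζ`. -/
def modF (ζ : ℂˣ) : U := F + (2 * (ζ : ℂ))⁻¹ • (Q * Q)

/-- The element `e - p² / 2ζ`, which commutes with `p` and `q` where `z` acts by `ζ`. -/
def modE (ζ : ℂˣ) : U := E - (2 * (ζ : ℂ))⁻¹ • (P * P)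

lemma modF_smul_modF_pow (v : M) (i j : ℕ) :
    modF ζ • (modF ζ ^ i * Q ^ j) • v = (modF ζ ^ (i + 1) * Q ^ j) • v := by
  rw [smul_smul, ← mul_assoc, pow_succ']

variable [Module ℂ M] [Module ℂ N]

lemma smul_H_F (x : M) : H • F • x = F • H • x - (2 : ℂ) • F • x := by
  rw [smul_smul, H_mul_F, sub_smul, mul_smul, two_mul, add_smul, two_smul]

/-- `v` is a highest weight vector with `h v = (μ - 1/2) v`, in a module on which `z` acts
by `ζ`. -/
structure IsHighestWeight (μ : ℂ) (ζ : ℂˣ) (v : M) : Prop where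
  E_smul : E • v = 0
  P_smul : P • v = 0
  H_smul : H • v = (μ - 1 / 2) • v
  Z_smul : ∀ x : M, Z • x = (ζ : ℂ) • x

lemma smul_P_Q (hZ : ∀ x : M, Z • x = (ζ : ℂ) • x) (x : M) :
    P • Q • x = Q • P • x + (ζ : ℂ) • x := by
  rw [smul_smul, P_mul_Q, add_smul, mul_smul, hZ]

/-- The linear map from the model that sends the standard basis to the vectors
`(f + q² / 2ζ)ⁱ qʲ v`. -/
def Model.toModuleAux (μ : ℂ) (ζ : ℂˣ) (v : M) : Model μ ζ →ₗ[ℂ] M :=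
  (Model.basis μ ζ).constr ℂ fun x => (modF ζ ^ x.1 * Q ^ x.2) • v

lemma Model.toModuleAux_b (v : M) (i j : ℕ) :
    toModuleAux μ ζ v (b μ ζ i j) = (modF ζ ^ i * Q ^ j) • v :=
  (basis μ ζ).constr_basis ℂ _ (i, j)

variable [IsScalarTower ℂ U M] [IsScalarTower ℂ U N]

/-- A `ℂ`-linear map that commutes with the generators is `U`-linear. -/
lemma map_smul_of_map_gen_smul {T : M →ₗ[ℂ] N} (h : ∀ g x, T (gen g • x) = gen g • T x)
    (u : U) (x : M) : T (u • x) = u • T x := by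
  obtain ⟨a, rfl⟩ := RingQuot.mkAlgHom_surjective ℂ Rel u
  induction a using FreeAlgebra.induction generalizing x with
  | grade0 r => simp only [AlgHom.commutes, algebraMap_smul, map_smul]
  | grade1 g => exact h g x
  | mul a b ha hb => simp only [map_mul, mul_smul, ha, hb]
  | add a b ha hb => simp only [map_add, add_smul, ha, hb]

lemma Z_mul (u : U) : Z * u = u * Z := by
  simpa using map_smul_of_map_gen_smul (T := LinearMap.mulLeft ℂ Z)
    (fun g x => by
      simp only [LinearMap.mulLeft_apply, smul_eq_mul, ← mul_assoc, Z_mul_gen]) u 1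

lemma modF_smul (x : M) : modF ζ • x = F • x + (2 * (ζ : ℂ))⁻¹ • Q • Q • x := by
  rw [modF, add_smul, smul_assoc, mul_smul]

lemma modE_smul (x : M) : modE ζ • x = E • x - (2 * (ζ : ℂ))⁻¹ • P • P • x := by
  rw [modE, sub_smul, smul_assoc, mul_smul]

lemma smul_Q_modF (x : M) : Q • modF ζ • x = modF ζ • Q • x := by
  simp only [modF_smul, smul_add, smul_comm Q (_ : ℂ), smul_Q_F]

lemma smul_H_modF (x : M) : H • modF ζ • x = modF ζ • H • x - (2 : ℂ) • modF ζ • x := by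
  simp only [modF_smul, smul_add, smul_sub, smul_comm H (_ : ℂ), smul_H_F, smul_H_Q]
  simp only [← act_def]
  module

section Central

variable (hZ : ∀ x : M, Z • x = (ζ : ℂ) • x)
include hZ

lemma smul_P_modF (x : M) : P • modF ζ • x = modF ζ • P • x := by
  have hζ : (ζ : ℂ) ≠ 0 := ζ.ne_zero
  simp only [modF_smul, smul_add, smul_comm P (_ : ℂ), smul_P_F, smul_P_Q hZ, smul_comm Q (_ : ℂ)]
  simp only [← act_def]
  match_scalars <;> field_simp
  ring

lemma smul_modE_Q (x : M) : modE ζ • Q • x = Q • modE ζ • x := by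
  have hζ : (ζ : ℂ) ≠ 0 := ζ.ne_zero
  simp only [modE_smul, smul_add, smul_sub, smul_comm P (_ : ℂ), smul_E_Q, smul_P_Q hZ,
    smul_comm Q (_ : ℂ)]
  simp only [← act_def]
  match_scalars <;> field_simp
  ring

lemma smul_modE_modF (x : M) : modE ζ • modF ζ • x =
    modF ζ • modE ζ • x + (H • x + (ζ : ℂ)⁻¹ • Q • P • x + (1 / 2 : ℂ) • x) := by
  have hζ : (ζ : ℂ) ≠ 0 := ζ.ne_zero
  simp only [modF_smul, modE_smul, smul_add, smul_sub, smul_comm P (_ : ℂ), smul_comm E (_ : ℂ),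
    smul_comm F (_ : ℂ), smul_comm Q (_ : ℂ), smul_E_Q, smul_E_F, smul_P_F, smul_P_Q hZ]
  simp only [← act_def]
  match_scalars <;> field_simp <;> ring

end Central

lemma smul_Q_modF_pow (v : M) (i j : ℕ) :
    Q • (modF ζ ^ i * Q ^ j) • v = (modF ζ ^ i * Q ^ (j + 1)) • v := by
  induction i with
  | zero => simp only [pow_zero, one_mul, pow_succ', mul_smul]
  | succ i ih => rw [pow_succ', mul_assoc, mul_smul, smul_Q_modF, ih, mul_assoc, mul_smul (modF ζ)]

lemma smul_F_modF_pow (v : M) (i j : ℕ) : F • (modF ζ ^ i * Q ^ j) • v =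
    (modF ζ ^ (i + 1) * Q ^ j) • v - (2 * (ζ : ℂ))⁻¹ • (modF ζ ^ i * Q ^ (j + 2)) • v := by
  rw [← modF_smul_modF_pow, modF_smul, smul_Q_modF_pow, smul_Q_modF_pow, add_sub_cancel_right]

namespace IsHighestWeight

variable {v : M} (hv : IsHighestWeight μ ζ v)
include hv

lemma P_smul_pow (i j : ℕ) : P • (modF ζ ^ i * Q ^ j) • v =
    ((ζ : ℂ) * j) • (modF ζ ^ i * Q ^ (j - 1)) • v := by
  induction i with
  | zero =>
    induction j with
    | zero => simp [hv.P_smul]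
    | succ j ih =>
      rw [← smul_Q_modF_pow, smul_P_Q hv.Z_smul, ih, smul_comm Q, smul_Q_modF_pow]
      rcases j with _ | j <;> simp only [Nat.add_sub_cancel] <;> push_cast
      · simp
      · simp only [← act_def]
        module
  | succ i ih =>
    rw [← modF_smul_modF_pow, smul_P_modF hv.Z_smul, ih, smul_comm (modF ζ), modF_smul_modF_pow]

lemma H_smul_pow (i j : ℕ) : H • (modF ζ ^ i * Q ^ j) • v =
    (μ - 2 * i - j - 1 / 2 : ℂ) • (modF ζ ^ i * Q ^ j) • v := by
  induction i with
  | zero =>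
    induction j with
    | zero => simp [hv.H_smul]
    | succ j ih =>
      rw [← smul_Q_modF_pow, smul_H_Q, ih, smul_comm Q]
      push_cast
      simp only [← act_def]
      module
  | succ i ih =>
    rw [← modF_smul_modF_pow, smul_H_modF, ih, smul_comm (modF ζ)]
    push_cast
    simp only [← act_def]
    module

lemma modE_smul_pow (i j : ℕ) : modE ζ • (modF ζ ^ i * Q ^ j) • v =
    ((i : ℂ) * (μ - i + 1)) • (modF ζ ^ (i - 1) * Q ^ j) • v := by
  have hζ : (ζ : ℂ) ≠ 0 := ζ.ne_zero
  induction i with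
  | zero =>
    induction j with
    | zero => simp [modE_smul, hv.E_smul, hv.P_smul]
    | succ j ih => rw [← smul_Q_modF_pow, smul_modE_Q hv.Z_smul, ih]; simp
  | succ i ih =>
    rw [← modF_smul_modF_pow, smul_modE_modF hv.Z_smul, ih, smul_comm (modF ζ),
      modF_smul_modF_pow, hv.H_smul_pow, hv.P_smul_pow, smul_comm Q, smul_Q_modF_pow]
    rcases i with _ | i <;> rcases j with _ | j <;>
      simp only [Nat.add_sub_cancel, Nat.zero_add] <;> push_cast <;>
      simp only [← act_def] <;>
      match_scalars <;> field_simp <;> ring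

lemma E_smul_pow (i j : ℕ) : E • (modF ζ ^ i * Q ^ j) • v =
    ((i : ℂ) * (μ - i + 1)) • (modF ζ ^ (i - 1) * Q ^ j) • v +
      ((ζ : ℂ) / 2 * j * (j - 1)) • (modF ζ ^ i * Q ^ (j - 2)) • v := by
  have hζ : (ζ : ℂ) ≠ 0 := ζ.ne_zero
  have h := hv.modE_smul_pow i j
  rw [modE_smul, hv.P_smul_pow, smul_comm P, hv.P_smul_pow, sub_eq_iff_eq_add] at h
  rw [h]
  rcases j with _ | j
  · simp
  · rw [Nat.add_sub_cancel, show j + 1 - 2 = j - 1 by lia]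
    push_cast
    simp only [← act_def]
    match_scalars
    · rfl
    · field_simp
      ring

end IsHighestWeight

lemma Model.map_gen_smul_of_b {T : Model μ ζ →ₗ[ℂ] M}
    (h : ∀ g i j, T (gen g • b μ ζ i j) = gen g • T (b μ ζ i j)) (g : Gen) (x : Model μ ζ) :
    T (gen g • x) = gen g • T x :=
  LinearMap.congr_fun (hom_ext (S := T ∘ₗ Algebra.lsmul ℂ ℂ _ (gen g))
    (T := Algebra.lsmul ℂ ℂ _ (gen g) ∘ₗ T) (h g)) x

/-- The universal property of the model. -/
def Model.toModule {v : M} (hv : IsHighestWeight μ ζ v) : Model μ ζ →ₗ[U] M where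
  __ := toModuleAux μ ζ v
  map_smul' := map_smul_of_map_gen_smul <| map_gen_smul_of_b fun g i j => by
    rw [toModuleAux_b]
    cases g
    · change toModuleAux μ ζ v (E • _) = E • _
      rw [E_smul_b, hv.E_smul_pow]
      simp only [map_add, map_smul, toModuleAux_b]
    · change toModuleAux μ ζ v (H • _) = H • _
      rw [H_smul_b, hv.H_smul_pow]
      simp only [map_smul, toModuleAux_b]
    · change toModuleAux μ ζ v (F • _) = F • _
      rw [F_smul_b, smul_F_modF_pow]
      simp only [map_sub, map_smul, toModuleAux_b]
    · change toModuleAux μ ζ v (P • _) = P • _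
      rw [P_smul_b, hv.P_smul_pow]
      simp only [map_smul, toModuleAux_b]
    · change toModuleAux μ ζ v (Q • _) = Q • _
      rw [Q_smul_b, smul_Q_modF_pow]
      simp only [toModuleAux_b]
    · change toModuleAux μ ζ v (Z • _) = Z • _
      rw [Z_smul_b, hv.Z_smul]
      simp only [map_smul, toModuleAux_b]

lemma Model.toModule_b {v : M} (hv : IsHighestWeight μ ζ v) (i j : ℕ) :
    toModule hv (b μ ζ i j) = (modF ζ ^ i * Q ^ j) • v :=
  toModuleAux_b v i j

end Modules

namespace Model

lemma modF_smul_b (i j : ℕ) : modF ζ • b μ ζ i j = b μ ζ (i + 1) j := by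
  rw [modF_smul, F_smul_b, Q_smul_b, Q_smul_b, sub_add_cancel]

lemma b_eq_smul (i j : ℕ) : b μ ζ i j = (modF ζ ^ i * Q ^ j) • b μ ζ 0 0 := by
  induction i with
  | zero =>
    induction j with
    | zero => simp
    | succ j ih => rw [← smul_Q_modF_pow, ← ih, Q_smul_b]
  | succ i ih => rw [← modF_smul_modF_pow, ← ih, modF_smul_b]

lemma isHighestWeight_b : IsHighestWeight μ ζ (b μ ζ 0 0) where
  E_smul := by simp [E_smul_b]
  P_smul := by simp [P_smul_b]
  H_smul := by simp [H_smul_b]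
  Z_smul x := by
    rw [Z, gen_smul]
    exact LinearMap.congr_fun (hom_ext (S := genOp μ ζ .Z) (T := (ζ : ℂ) • LinearMap.id)
      fun i j => genOp_Z i j) x

end Model

section Verma

variable {hh : ℂ} (h : hh = μ - 1 / 2)
include h

lemma isHighestWeight_hwVec : IsHighestWeight μ ζ (hwVec hh ζ) := by
  have key (u : U) (hu : u ∈ ({E, P, H - sc hh, Z - sc ζ} : Set U)) : u • hwVec hh ζ = 0 := by
    rw [hwVec, ← Submodule.Quotient.mk_smul, Submodule.Quotient.mk_eq_zero, smul_eq_mul, mul_one]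
    exact Submodule.subset_span hu
  have keyZ : Z • hwVec hh ζ = (ζ : ℂ) • hwVec hh ζ := by
    have := key (Z - sc ζ) (by simp)
    rwa [sub_smul, sub_eq_zero, sc, algebraMap_smul] at this
  refine ⟨key _ (by simp), key _ (by simp), ?_, fun x => ?_⟩
  · have := key (H - sc hh) (by simp)
    rw [sub_smul, sub_eq_zero, sc, algebraMap_smul] at this
    rw [this, h]
  · obtain ⟨u, rfl⟩ := Submodule.Quotient.mk_surjective _ x
    have hu : (Submodule.Quotient.mk u : Verma hh ζ) = u • hwVec hh ζ := by
      rw [hwVec, ← Submodule.Quotient.mk_smul, smul_eq_mul, mul_one]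
    rw [hu, smul_smul, Z_mul, mul_smul, keyZ, smul_comm]

/-- The universal property of the Verma module. -/
def vermaLift {M : Type*} [AddCommGroup M] [Module ℂ M] [Module U M] [IsScalarTower ℂ U M] {v : M}
    (hv : IsHighestWeight μ ζ v) : Verma hh ζ →ₗ[U] M :=
  (vermaIdeal hh ζ).liftQ (LinearMap.toSpanSingleton U M v) <| by
    rw [vermaIdeal, Submodule.span_le]
    rintro u (rfl | rfl | rfl | rfl)
    · simpa using hv.E_smul
    · simpa using hv.P_smul
    · simp [sub_smul, sc, algebraMap_smul, hv.H_smul, h]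
    · simp [sub_smul, sc, algebraMap_smul, hv.Z_smul]

lemma vermaLift_hwVec {M : Type*} [AddCommGroup M] [Module ℂ M] [Module U M]
    [IsScalarTower ℂ U M] {v : M} (hv : IsHighestWeight μ ζ v) :
    vermaLift h hv (hwVec hh ζ) = v := by
  rw [hwVec, vermaLift, Submodule.liftQ_apply, LinearMap.toSpanSingleton_apply, one_smul]

/-- The Verma module is isomorphic to the model. -/
def vermaEquiv : Verma hh ζ ≃ₗ[U] Model μ ζ :=
  LinearEquiv.ofLinearMap (vermaLift h Model.isHighestWeight_b)
    (Model.toModule (isHighestWeight_hwVec h))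
    (LinearMap.restrictScalars_injective ℂ <| Model.hom_ext fun i j => by
      simp only [LinearMap.restrictScalars_apply, LinearMap.comp_apply, Model.toModule_b,
        map_smul, vermaLift_hwVec, LinearMap.id_apply, ← Model.b_eq_smul])
    (Submodule.linearMap_qext _ <| LinearMap.ext_ring <| by
      change Model.toModule (isHighestWeight_hwVec h) (vermaLift h _ (hwVec hh ζ)) = hwVec hh ζ
      rw [vermaLift_hwVec, Model.toModule_b, pow_zero, pow_zero, one_mul, one_smul])

end Verma

namespace Model

lemma modF_Q_pow_smul_b (i j k : ℕ) :
    (modF ζ ^ i * Q ^ j) • b μ ζ k 0 = b μ ζ (i + k) j := by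
  rw [b_eq_smul k, b_eq_smul (i + k), pow_zero, mul_one, smul_smul, pow_add, mul_assoc, mul_assoc,
    (Commute.pow_pow (show Commute Q (modF ζ) from ?_) j k).eq]
  rw [modF, commute_iff_eq, mul_add, add_mul, F_mul_Q, mul_smul_comm, smul_mul_assoc, mul_assoc]

lemma isHighestWeight_singular (m : ℕ) :
    IsHighestWeight (-m - 2) ζ (b (m : ℂ) ζ (m + 1) 0) where
  E_smul := by simp [E_smul_b]
  P_smul := by simp [P_smul_b]
  H_smul := by
    rw [H_smul_b]
    congr 1
    push_cast
    ring
  Z_smul := isHighestWeight_b.Z_smul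

/-- The embedding of models given by the singular vector `(f + q² / 2ζ)ᵐ⁺¹ v`. -/
def embed (m : ℕ) (ζ : ℂˣ) : Model (-m - 2 : ℂ) ζ →ₗ[U] Model (m : ℂ) ζ :=
  toModule (isHighestWeight_singular m)

lemma embed_b (m i j : ℕ) : embed m ζ (b _ ζ i j) = b _ ζ (i + (m + 1)) j := by
  rw [embed, toModule_b, modF_Q_pow_smul_b]

lemma embed_injective (m : ℕ) : Function.Injective (embed m ζ) := by
  let T : Model (m : ℂ) ζ →ₗ[ℂ] Model (-m - 2 : ℂ) ζ :=
    (basis _ ζ).constr ℂ fun x => b _ ζ (x.1 - (m + 1)) x.2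
  have hT : T ∘ₗ (embed m ζ).restrictScalars ℂ = LinearMap.id := hom_ext fun i j => by
    rw [LinearMap.comp_apply, LinearMap.restrictScalars_apply, embed_b]
    refine ((basis _ ζ).constr_basis ℂ _ (i + (m + 1), j)).trans ?_
    simp
  exact Function.LeftInverse.injective (g := T) fun x => LinearMap.congr_fun hT x

lemma repr_b (i j : ℕ) : (basis μ ζ).repr (b μ ζ i j) = Finsupp.single (i, j) 1 :=
  (basis μ ζ).repr_self (i, j)

lemma sum_repr_mem {N : Submodule U (Model μ ζ)} {x : Model μ ζ}
    (h : ∀ i j, (basis μ ζ).repr x (i, j) ≠ 0 → b μ ζ i j ∈ N) : x ∈ N := by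
  rw [← (basis μ ζ).linearCombination_repr x, Finsupp.linearCombination_apply, Finsupp.sum]
  exact N.sum_mem fun y hy =>
    N.smul_of_tower_mem _ (h y.1 y.2 (Finsupp.mem_support_iff.mp hy))

lemma eq_top_of_b_mem {N : Submodule U (Model μ ζ)} (h : b μ ζ 0 0 ∈ N) : N = ⊤ :=
  eq_top_iff.mpr fun _ _ => sum_repr_mem fun i j _ => by
    rw [b_eq_smul]
    exact N.smul_mem _ h

lemma b_notMem_range_embed (m : ℕ) : b _ ζ 0 0 ∉ LinearMap.range (embed m ζ) := by
  rintro ⟨x, hx⟩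
  have h0 : (basis _ ζ).coord (0, 0) ∘ₗ (embed m ζ).restrictScalars ℂ = 0 := hom_ext fun i j => by
    simp [embed_b, repr_b]
  have h1 := LinearMap.congr_fun h0 x
  simp [hx, repr_b] at h1

/-- The coordinates of `u • x`, for `u` acting diagonally on the standard basis. -/
lemma repr_smul_of_diagonal {u : U} {d : ℕ → ℕ → ℂ}
    (h : ∀ i j, u • b μ ζ i j = d i j • b μ ζ i j) (x : Model μ ζ) (i j : ℕ) :
    (basis μ ζ).repr (u • x) (i, j) = d i j * (basis μ ζ).repr x (i, j) := by
  refine LinearMap.congr_fun (hom_ext (S := (basis μ ζ).coord (i, j) ∘ₗ Algebra.lsmul ℂ ℂ _ u)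
    (T := d i j • (basis μ ζ).coord (i, j)) fun k l => ?_) x
  by_cases hkl : (k, l) = (i, j)
  · obtain ⟨rfl, rfl⟩ := Prod.mk.inj hkl
    simp [h, repr_b]
  · simp [h, repr_b, hkl]

/-- Distinct vectors of the standard basis are separated by an element of `U` that acts
diagonally. -/
lemma exists_diagonal {i j k l : ℕ} (hne : (i, j) ≠ (k, l)) : ∃ (u : U) (d : ℕ → ℕ → ℂ),
    (∀ i j, u • b μ ζ i j = d i j • b μ ζ i j) ∧ d i j ≠ d k l := by
  by_cases hjl : j = l
  · subst hjl
    refine ⟨H, _, H_smul_b, fun h => hne ?_⟩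
    have : (i : ℂ) = k := by linear_combination (-1 / 2) * h
    rw [Nat.cast_inj.mp this]
  · refine ⟨Q * P, fun _ j => ζ * j, fun i j => ?_, fun h => hjl ?_⟩
    · rw [mul_smul, P_smul_b, smul_comm Q, Q_smul_b]
      rcases j with _ | j <;> simp
    · exact Nat.cast_inj.mp (mul_left_cancel₀ ζ.ne_zero h)

/-- A submodule of the model contains every standard basis vector that occurs in one of its
elements. -/
lemma b_mem_of_repr_ne_zero {N : Submodule U (Model μ ζ)} {x : Model μ ζ} (hx : x ∈ N) {i j : ℕ}
    (hij : (basis μ ζ).repr x (i, j) ≠ 0) : b μ ζ i j ∈ N := by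
  induction hn : ((basis μ ζ).repr x).support.card using Nat.strong_induction_on generalizing x with
  | _ n ih =>
  by_cases hex : ∃ k l, (i, j) ≠ (k, l) ∧ (basis μ ζ).repr x (k, l) ≠ 0
  · obtain ⟨k, l, hne, hkl⟩ := hex
    obtain ⟨u, d, hd, hdne⟩ := exists_diagonal (μ := μ) (ζ := ζ) hne
    have hrepr (y : ℕ × ℕ) : (basis μ ζ).repr (u • x - d k l • x) y =
        (d y.1 y.2 - d k l) * (basis μ ζ).repr x y := by
      rw [map_sub, Finsupp.sub_apply, repr_smul_of_diagonal hd, map_smul, Finsupp.smul_apply,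
        smul_eq_mul, sub_mul]
    refine ih _ ?_ (N.sub_mem (N.smul_mem u hx) (N.smul_of_tower_mem (d k l) hx)) ?_ rfl
    · rw [← hn]
      refine Finset.card_lt_card (Finset.ssubset_iff_subset_ne.mpr ⟨fun y hy => ?_, fun h => ?_⟩)
      · rw [Finsupp.mem_support_iff, hrepr] at hy
        exact Finsupp.mem_support_iff.mpr (right_ne_zero_of_mul hy)
      · have := h.symm ▸ Finsupp.mem_support_iff.mpr hkl
        rw [Finsupp.mem_support_iff, hrepr, sub_self, zero_mul] at this
        exact this rfl
    · rw [hrepr]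
      exact mul_ne_zero (sub_ne_zero.mpr hdne) hij
  · push Not at hex
    have hsum : x = (basis μ ζ).repr x (i, j) • b μ ζ i j := by
      refine (basis μ ζ).repr.injective (Finsupp.ext fun y => ?_)
      rw [map_smul, repr_b, Finsupp.smul_single, smul_eq_mul, mul_one]
      by_cases hy : (i, j) = y
      · rw [← hy, Finsupp.single_eq_same]
      · rw [Finsupp.single_apply, if_neg hy, hex y.1 y.2 hy]
    rw [← inv_smul_smul₀ hij (b μ ζ i j), ← hsum]
    exact N.smul_of_tower_mem _ hx

lemma b_zero_mem_of_b_mem {m : ℕ} {N : Submodule U (Model (m : ℂ) ζ)} {i j : ℕ} (hi : i ≤ m)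
    (h : b _ ζ i j ∈ N) : b _ ζ 0 0 ∈ N := by
  induction j with
  | succ j ih =>
    have hc : (ζ : ℂ) * (j + 1 : ℕ) ≠ 0 := mul_ne_zero ζ.ne_zero (Nat.cast_ne_zero.mpr (by lia))
    have hP := N.smul_mem P h
    rw [P_smul_b, Nat.add_sub_cancel] at hP
    refine ih ?_
    rw [← inv_smul_smul₀ hc (b _ ζ i j)]
    exact N.smul_of_tower_mem _ hP
  | zero =>
    induction i with
    | zero => exact h
    | succ i ih =>
      have hc : ((i + 1 : ℕ) : ℂ) * (m - (i + 1 : ℕ) + 1) ≠ 0 := by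
        refine mul_ne_zero (Nat.cast_ne_zero.mpr (by lia)) ?_
        rw [← Nat.cast_sub hi]
        exact Nat.cast_add_one_ne_zero _
      have hE := N.smul_mem E h
      rw [E_smul_b, Nat.add_sub_cancel, Nat.cast_zero, mul_zero, zero_mul, zero_smul,
        add_zero] at hE
      refine ih (by lia) ?_
      rw [← inv_smul_smul₀ hc (b _ ζ i 0)]
      exact N.smul_of_tower_mem _ hE

lemma le_range_embed_of_ne_top {m : ℕ} {N : Submodule U (Model (m : ℂ) ζ)} (hN : N ≠ ⊤) :
    N ≤ LinearMap.range (embed m ζ) := fun x hx => sum_repr_mem fun i j hij => by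
  by_cases hi : i ≤ m
  · exact absurd (eq_top_of_b_mem (b_zero_mem_of_b_mem hi (b_mem_of_repr_ne_zero hx hij))) hN
  · exact ⟨b _ ζ (i - (m + 1)) j, by rw [embed_b, Nat.sub_add_cancel (by lia)]⟩

end Model

end

/-- Proposition 4(ii) of the paper: let `λ(z) = zz ≠ 0` and
`λ(h) = hh ∈ {-1/2, 1/2, 3/2, 5/2, …}`.  Then there is a non-split short exact
sequence `0 → Δ(r·λ) → Δ(λ) → L(λ) → 0`, where `(r·λ)(h) = -λ(h) - 3` and
`(r·λ)(z) = λ(z)`.  Here `L(λ) = Δ(λ)/K(λ)` is the unique simple quotient of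
`Δ(λ)`, `K(λ)` its unique maximal submodule; the sequence is realized by an
injective `U`-module map `Δ(r·λ) → Δ(λ)` with image `K(λ)`, and non-splitness
means that `K(λ)` has no complement in `Δ(λ)`. -/
theorem verma_nonsplit_ses (hh zz : ℂ) (hzz : zz ≠ 0) (m : ℕ)
    (hm : hh = (m : ℂ) - 1 / 2) :
    ∃ φ : Verma (-hh - 3) zz →ₗ[U] Verma hh zz,
      Function.Injective φ ∧
      LinearMap.range φ = vermaRad hh zz ∧
      ¬ ∃ C : Submodule U (Verma hh zz), IsCompl (vermaRad hh zz) C := by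
  obtain ⟨ζ, rfl⟩ : ∃ ζ : ℂˣ, (ζ : ℂ) = zz := ⟨Units.mk0 zz hzz, rfl⟩
  let e := vermaEquiv (ζ := ζ) hm
  let e' := vermaEquiv (hh := -hh - 3) (μ := -m - 2) (ζ := ζ) (by rw [hm]; ring)
  let φ : Verma (-hh - 3) ζ →ₗ[U] Verma hh ζ := e.symm ∘ₗ Model.embed m ζ ∘ₗ e'
  have hle (N : Submodule U (Verma hh ζ)) (hN : N ≠ ⊤) : N ≤ LinearMap.range φ := by
    have hN' : N.map (e : Verma hh ζ →ₗ[U] Model m ζ) ≠ ⊤ := fun h =>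
      hN (Submodule.map_injective_of_injective e.injective (by
        rw [h, Submodule.map_top, LinearEquiv.range]))
    intro x hx
    obtain ⟨y, hy⟩ := Model.le_range_embed_of_ne_top hN' (Submodule.mem_map_of_mem hx)
    refine ⟨e'.symm y, ?_⟩
    change e.symm (Model.embed m ζ (e' (e'.symm y))) = x
    rw [e'.apply_symm_apply, hy]
    exact e.symm_apply_apply x
  have hne : LinearMap.range φ ≠ ⊤ := fun h => by
    obtain ⟨x, hx⟩ := LinearMap.range_eq_top.mp h (e.symm (Model.b _ ζ 0 0))
    exact Model.b_notMem_range_embed m ⟨e' x, e.symm.injective hx⟩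
  have hrad : LinearMap.range φ = vermaRad hh ζ :=
    le_antisymm (le_sSup hne) (sSup_le hle)
  have hinj : Function.Injective φ :=
    e.symm.injective.comp ((Model.embed_injective m).comp e'.injective)
  refine ⟨φ, hinj, hrad, ?_⟩
  rintro ⟨C, hC⟩
  rw [← hrad] at hC
  by_cases hCtop : C = ⊤
  · rw [hCtop] at hC
    have hbot := disjoint_top.mp hC.disjoint
    rw [LinearMap.range_eq_bot] at hbot
    have h0 : e'.symm (Model.b _ ζ 0 0) = 0 := hinj (by rw [hbot]; rfl)
    have h1 : Model.b (-m - 2 : ℂ) ζ 0 0 = 0 := by simpa using h0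
    exact (Model.basis _ ζ).ne_zero (0, 0) h1
  · exact hne (by rw [← hC.sup_eq_top, sup_eq_left.mpr (hle C hCtop)])

end Schrodinger
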